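/- For every n ≥ 1, every DBA over Fin 3 with finite state type Q whose language equals L_n^ω satisfies (n + 2) · Fintype.card Q ≥ 2^n (i.e. it has at least 2^n / (n + 2) states). -/

import Mathlib

/-- The unique run of a deterministic Büchi automaton with transition function `δ`
and initial state `q0` on the ω-word `α`. -/
def dbaRun {Q : Type} (δ : Q → Fin 3 → Q) (q0 : Q) (α : ℕ → Fin 3) : ℕ → Q
  | 0 => q0
  | i + 1 => δ (dbaRun δ q0 α i) (α i)

/-- `LnOmega n` is the ω-language `L_n^ω`: ω-words containing infinitely many factors
from `1·{0,1}^{n-1}·2` (letter `2 : Fin 3` plays the role of the end-marker `$`). -/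
def LnOmega (n : ℕ) : Set (ℕ → Fin 3) :=
  {α | {i : ℕ | α i = 1 ∧ (∀ k, 1 ≤ k → k < n → α (i + k) ≠ 2) ∧ α (i + n) = 2}.Infinite}

def HasFac (n : ℕ) (z : List (Fin 3)) : Prop :=
  ∃ i, z[i]? = some 1 ∧ (∀ k, 1 ≤ k → k < n → z[i + k]? ≠ some 2) ∧ z[i + n]? = some 2

def EndsTwo (z : List (Fin 3)) : Prop := 0 < z.length ∧ z[z.length - 1]? = some 2

def GoodW (n : ℕ) (z : List (Fin 3)) : Prop := z = [] ∨ (EndsTwo z ∧ ¬ HasFac n z)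

lemma endsTwo_append {a b : List (Fin 3)} (hb : EndsTwo b) : EndsTwo (a ++ b) := by
  obtain ⟨h0, h1⟩ := hb
  refine ⟨by simp; omega, ?_⟩
  rw [List.getElem?_append_right (by simp; omega)]
  rw [← h1]; congr 1; simp; omega

lemma hasFac_append {n : ℕ} {a b : List (Fin 3)} (ha : EndsTwo a)
    (h : HasFac n (a ++ b)) : HasFac n a ∨ HasFac n b := by
  obtain ⟨h0, h1⟩ := ha
  obtain ⟨i, hi, hk, hn⟩ := h
  by_cases c : i < a.length
  · by_cases d : i + n < a.length
    · left
      refine ⟨i, ?_, ?_, ?_⟩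
      · rwa [List.getElem?_append_left c] at hi
      · intro k k1 k2
        have := hk k k1 k2
        rwa [List.getElem?_append_left (by omega)] at this
      · rwa [List.getElem?_append_left d] at hn
    · exfalso
      by_cases e : i = a.length - 1
      · rw [List.getElem?_append_left c, e, h1] at hi
        simp at hi
      · have := hk (a.length - 1 - i) (by omega) (by omega)
        apply this
        rw [show i + (a.length - 1 - i) = a.length - 1 by omega,
          List.getElem?_append_left (by omega), h1]
  · right
    refine ⟨i - a.length, ?_, ?_, ?_⟩
    · rwa [List.getElem?_append_right (by omega)] at hi
    · intro k k1 k2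
      have := hk k k1 k2
      rwa [List.getElem?_append_right (by omega),
        show i + k - a.length = i - a.length + k by omega] at this
    · rwa [List.getElem?_append_right (by omega),
        show i + n - a.length = i - a.length + n by omega] at hn

lemma goodW_append {n : ℕ} {a b : List (Fin 3)} (ha : GoodW n a) (hb : GoodW n b) :
    GoodW n (a ++ b) := by
  rcases ha with rfl | ⟨ha, ha'⟩
  · simpa using hb
  rcases hb with rfl | ⟨hb, hb'⟩
  · rw [List.append_nil]; exact Or.inr ⟨ha, ha'⟩
  · right
    refine ⟨endsTwo_append hb, fun h => ?_⟩
    rcases hasFac_append ha h with h | h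
    · exact ha' h
    · exact hb' h

def lasso (w z : List (Fin 3)) (i : ℕ) : Fin 3 :=
  if i < w.length then w.getD i 0 else z.getD ((i - w.length) % z.length) 0

lemma lasso_left {w z : List (Fin 3)} {i : ℕ} (h : i < w.length) :
    some (lasso w z i) = w[i]? := by
  simp [lasso, h]

lemma lasso_right {w z : List (Fin 3)} {i : ℕ} (k : ℕ) (h : i < z.length) :
    some (lasso w z (w.length + k * z.length + i)) = z[i]? := by
  have : (w.length + k * z.length + i - w.length) % z.length = i := by
    rw [show w.length + k * z.length + i - w.length = i + k * z.length by omega,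
      Nat.add_mul_mod_self_right, Nat.mod_eq_of_lt h]
  unfold lasso
  rw [if_neg (by omega), this]
  simp [h]

lemma run_left {Q : Type} (δ : Q → Fin 3 → Q) (q0 : Q) (w z : List (Fin 3)) (i : ℕ)
    (h : i ≤ w.length) : dbaRun δ q0 (lasso w z) i = (w.take i).foldl δ q0 := by
  induction i with
  | zero => simp [dbaRun]
  | succ i ih =>
    rw [dbaRun, ih (by omega), List.take_add_one, ← lasso_left (z := z) (by omega)]
    simp

lemma run_right {Q : Type} (δ : Q → Fin 3 → Q) (q0 p : Q) (w z : List (Fin 3))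
    (hw : w.foldl δ q0 = p) (hz : z.foldl δ p = p) (k i : ℕ)
    (h : i ≤ z.length) :
    dbaRun δ q0 (lasso w z) (w.length + k * z.length + i) = (z.take i).foldl δ p := by
  induction k generalizing i with
  | zero =>
    induction i with
    | zero => simp [run_left, hw]
    | succ i ih =>
      rw [← add_assoc, dbaRun, ih (by omega), List.take_add_one,
        ← lasso_right (w := w) 0 (by omega)]
      simp
  | succ k ihk =>
    induction i with
    | zero =>
      have := ihk z.length le_rfl
      rw [List.take_length, hz] at this
      rw [show w.length + (k + 1) * z.length + 0 = w.length + k * z.length + z.length by ring, this]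
      simp
    | succ i ih =>
      rw [← add_assoc, dbaRun, ih (by omega), List.take_add_one,
        ← lasso_right (w := w) (k+1) (by omega)]
      simp

lemma decomp (a m i : ℕ) (hm : 0 < m) (h : a ≤ i) : ∃ k j, j < m ∧ i = a + k * m + j := by
  refine ⟨(i - a) / m, (i - a) % m, Nat.mod_lt _ hm, ?_⟩
  have := Nat.div_add_mod' (i - a) m
  omega

lemma inf_of_periodic {s : Set ℕ} (a m j : ℕ) (hm : 0 < m) (h : ∀ k, a + k * m + j ∈ s) :
    s.Infinite := by
  rw [Set.infinite_iff_exists_gt]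
  intro b
  refine ⟨_, h (b + 1), ?_⟩
  have : (b + 1) * 1 ≤ (b + 1) * m := Nat.mul_le_mul_left _ hm
  omega

lemma mem_of_hasFac {n : ℕ} (w z : List (Fin 3)) (h : HasFac n z) :
    lasso w z ∈ LnOmega n := by
  obtain ⟨i, hi, hk, hn⟩ := h
  have hl : i + n < z.length := by
    by_contra c
    rw [List.getElem?_eq_none (by omega)] at hn
    simp at hn
  refine inf_of_periodic w.length z.length i (by omega) fun k => ⟨?_, ?_, ?_⟩
  · rw [← lasso_right (w := w) k (by omega)] at hi
    simpa using hi
  · intro m m1 m2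
    have := hk m m1 m2
    rw [← lasso_right (w := w) k (by omega)] at this
    simpa [add_assoc] using this
  · rw [← lasso_right (w := w) k (by omega)] at hn
    simpa [add_assoc] using hn

lemma not_mem_of_good {n : ℕ} (w z : List (Fin 3)) (hz : EndsTwo z) (h : ¬ HasFac n z) :
    lasso w z ∉ LnOmega n := by
  intro hm
  obtain ⟨h0, h1⟩ := hz
  obtain ⟨i, ⟨hi, hk, hn⟩, hgt⟩ := Set.infinite_iff_exists_gt.1 hm w.length
  obtain ⟨k, j, hj, rfl⟩ := decomp w.length z.length i h0 hgt.le
  have e : ∀ m, j + m < z.length →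
      some (lasso w z (w.length + k * z.length + j + m)) = z[j + m]? := by
    intro m hm
    rw [add_assoc, lasso_right k hm]
  by_cases d : j + n < z.length
  · apply h
    refine ⟨j, ?_, ?_, ?_⟩
    · rw [← lasso_right (w := w) k hj, hi]
    · intro m m1 m2
      rw [← e m (by omega)]
      simpa using hk m m1 m2
    · rw [← e n d, hn]
  · by_cases c : j = z.length - 1
    · rw [← c, ← lasso_right (w := w) k hj, hi] at h1
      simp at h1
    · apply hk (z.length - 1 - j) (by omega) (by omega)
      have := e (z.length - 1 - j) (by omega)
      rw [show j + (z.length - 1 - j) = z.length - 1 by omega, h1] at this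
      simpa using this

lemma goodW_bits {n i : ℕ} {l : List (Fin 3)} (h2 : ∀ x ∈ l, x ≠ 2) (hl : i + n = l.length)
    (hi : l[i]? ≠ some 1) (hn : 1 ≤ n) : GoodW n (l ++ [2]) := by
  right
  refine ⟨⟨by simp, by simp⟩, ?_⟩
  rintro ⟨j, hj, -, hjn⟩
  have : j + n = l.length := by
    by_contra c
    rcases lt_or_gt_of_ne c with c | c
    · rw [List.getElem?_append_left c] at hjn
      exact h2 _ (List.mem_of_getElem? hjn) rfl
    · rw [List.getElem?_eq_none (by simp; omega)] at hjn
      simp at hjn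
  have : j = i := by omega
  subst this
  rw [List.getElem?_append_left (by omega)] at hj
  exact hi hj

theorem stmt_10 (n : ℕ) (hn : 1 ≤ n) (Q : Type) [Fintype Q]
    (δ : Q → Fin 3 → Q) (q0 : Q) (F : Set Q)
    (hlang : {α : ℕ → Fin 3 | {i : ℕ | dbaRun δ q0 α i ∈ F}.Infinite} = LnOmega n) :
    2 ^ n ≤ (n + 2) * Fintype.card Q := by
  classical
  let R : Q → Set Q := fun p => {r | ∃ x, GoodW n x ∧ x.foldl δ p = r}
  have hself : ∀ p, p ∈ R p := fun p => ⟨[], Or.inl rfl, rfl⟩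
  have htrans : ∀ p r, r ∈ R p → R r ⊆ R p := by
    rintro p r ⟨x, hx, rfl⟩ s ⟨y, hy, rfl⟩
    exact ⟨x ++ y, goodW_append hx hy, by simp⟩
  obtain ⟨p, ⟨w, hwg, hw⟩, hmin⟩ := Set.exists_min_image (R q0) (fun p => (R p).ncard)
    (Set.toFinite _) ⟨q0, hself q0⟩
  have hback : ∀ r ∈ R p, p ∈ R r := by
    intro r hr
    have hr0 : r ∈ R q0 := htrans q0 p ⟨w, hwg, hw⟩ hr
    have := Set.eq_of_subset_of_ncard_le (htrans p r hr) (hmin r hr0) (Set.toFinite _)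
    rw [this]; exact hself p
  -- good words never visit F from p
  have hnoF : ∀ x, GoodW n x → ∀ i < x.length, (x.take i).foldl δ p ∉ F := by
    intro x hx i hi hF
    obtain ⟨y, hy, hyp⟩ := hback _ ⟨x, hx, rfl⟩
    have hz : (x ++ y).foldl δ p = p := by simpa using hyp
    have hg := goodW_append hx hy
    rcases hg with hg | ⟨he, hf⟩
    · simp at hg; simp [hg.1] at hi
    · apply not_mem_of_good w _ he hf
      rw [← hlang]
      refine inf_of_periodic w.length (x ++ y).length i he.1 fun k => ?_
      have hi' : i ≤ (x ++ y).length := by simp; omega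
      rw [Set.mem_setOf_eq, run_right δ q0 p w _ hw hz k i hi',
        List.take_append_of_le_length hi.le]
      exact hF
  -- injectivity
  let W : (Fin n → Bool) → List (Fin 3) := fun b => List.ofFn fun i => if b i then 1 else 0
  have hWl : ∀ b, (W b).length = n := fun b => by simp [W]
  have hW2 : ∀ b, ∀ x ∈ W b, x ≠ 2 := by
    intro b x hx
    simp only [W, List.mem_ofFn] at hx
    obtain ⟨i, rfl⟩ := hx
    split_ifs <;> decide
  have hWj : ∀ b (j : Fin n), (W b)[(j : ℕ)]? = some (if b j then 1 else 0) := by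
    intro b j
    simp [W]
  have key : ∀ b c (j : Fin n), b j = true → c j = false →
      (W b).foldl δ p = (W c).foldl δ p → False := by
    intro b c j hb hc heq
    have hz2 : ∀ d m, ∀ x ∈ W d ++ List.replicate m 0, x ≠ 2 := by
      intro d m x hx
      rcases List.mem_append.1 hx with hx | hx
      · exact hW2 d x hx
      · rw [List.eq_of_mem_replicate hx]; decide
    have g1 : GoodW n (W c ++ List.replicate j 0 ++ [2]) := by
      refine goodW_bits (i := j) (hz2 c j) (by simp [hWl]; omega) ?_ hn
      rw [List.getElem?_append_left (by rw [hWl]; exact j.2), hWj, hc]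
      simp
    have g2 : GoodW n (W b ++ List.replicate n 0 ++ [2]) := by
      refine goodW_bits (i := n) (hz2 b n) (by simp [hWl]) ?_ hn
      rw [List.getElem?_append_right (by rw [hWl])]
      simp [hWl, List.getElem?_replicate]
    obtain ⟨y, hy, hyp⟩ := hback _ ⟨_, g1, rfl⟩
    have g3 := goodW_append g1 hy
    have hz : (W b ++ (List.replicate j 0 ++ [2] ++ y)).foldl δ p = p := by
      refine Eq.trans ?_ hyp; simp [heq]
    have hfac : HasFac n (W b ++ (List.replicate j 0 ++ [2] ++ y)) := by
      refine ⟨j, ?_, ?_, ?_⟩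
      · rw [List.getElem?_append_left (by rw [hWl]; exact j.2), hWj, hb]; simp
      · intro k k1 k2 h
        rw [← List.append_assoc, ← List.append_assoc, List.append_assoc _ [2],
          List.getElem?_append_left (by simp [hWl]; omega)] at h
        exact hz2 b j _ (List.mem_of_getElem? h) rfl
      · rw [List.getElem?_append_right (by rw [hWl]; omega)]
        simp [hWl]
    have hmem := mem_of_hasFac w _ hfac
    rw [← hlang] at hmem
    obtain ⟨i, hi, hgt⟩ := Set.infinite_iff_exists_gt.1 hmem w.length
    obtain ⟨k, i, hil, rfl⟩ := decomp w.length
      (W b ++ (List.replicate j 0 ++ [2] ++ y)).length i (by simp) hgt.le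
    rw [Set.mem_setOf_eq, run_right δ q0 p w _ hw hz k i hil.le] at hi
    by_cases hin : i < n
    · apply hnoF _ g2 i (by simp [hWl]; omega)
      rw [List.append_assoc, List.take_append_of_le_length (by rw [hWl]; omega)]
      rwa [List.take_append_of_le_length (by rw [hWl]; omega)] at hi
    · apply hnoF _ g3 i (by simp [hWl] at hil ⊢; omega)
      rw [List.append_assoc, List.append_assoc, ← List.append_assoc _ [2], List.take_append,
        List.foldl_append, hWl, List.take_of_length_le (by rw [hWl]; omega), ← heq]
      rwa [List.take_append, List.foldl_append, hWl,
        List.take_of_length_le (by rw [hWl]; omega)] at hi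
  have hinj : Function.Injective fun b => (W b).foldl δ p := by
    intro b c h
    funext j
    by_contra hne
    cases hb : b j <;> cases hc : c j
    · simp [hb, hc] at hne
    · exact key c b j hc hb h.symm
    · exact key b c j hb hc h
    · simp [hb, hc] at hne
  have hcard := Fintype.card_le_of_injective _ hinj
  simp at hcard
  nlinarith
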